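/- For any full binary group-identification tree T (leaves labeled by disjoint nonempty pure subsets partitioning Θ), the expected number of queries to identify the group satisfies the exact identity Σ_{j ∈ leaves} π_{Θ_j} d_j = H(Π_y) + Σ_{a ∈ I} π_{Θ_a} [ 1 − H(ρ_a) + Σ_{i=1}^m (π_{Θ_a^i}/π_{Θ_a}) H(ρ_a^i) ], where the inner sum ranges over groups i with π_{Θ_a^i} > 0. -/

import Mathlib

/-- A full binary tree with leaves labeled by elements of `σ`. For group
identification, leaves are labeled by subsets of the object set. -/
inductive BTree (σ : Type) : Type where
  | leaf : σ → BTree σ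
  | node : BTree σ → BTree σ → BTree σ

namespace BTree

variable {σ : Type}

/-- The list of leaf labels of a tree. -/
def leaves : BTree σ → List σ
  | .leaf a => [a]
  | .node l r => leaves l ++ leaves r

/-- The list of leaf labels together with their depths (root has depth 0). -/
def leavesD : BTree σ → List (σ × ℕ)
  | .leaf a => [(a, 0)]
  | .node l r => (leavesD l ++ leavesD r).map fun p => (p.1, p.2 + 1)

/-- The list of internal nodes (as subtrees) together with their depths. -/
def internals : BTree σ → List (BTree σ × ℕ)
  | .leaf _ => []
  | .node l r => (.node l r, 0) :: ((internals l ++ internals r).map fun p => (p.1, p.2 + 1))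

/-- Left child (identity on leaves). -/
def left : BTree σ → BTree σ
  | .leaf a => .leaf a
  | .node l _ => l

/-- Right child (identity on leaves). -/
def right : BTree σ → BTree σ
  | .leaf a => .leaf a
  | .node _ r => r

variable {ι : Type} [DecidableEq ι]

/-- `objs t` is the set `Θ_a` of objects at the leaves of the subtree `t`. -/
def objs : BTree (Finset ι) → Finset ι
  | .leaf S => S
  | .node l r => objs l ∪ objs r

end BTree

variable {ι : Type} [DecidableEq ι] {m : ℕ}

/-- `π_{Θ_a}`, the total weight of the objects at the node rooting `t`. -/
noncomputable def gmass (π : ι → ℝ) (t : BTree (Finset ι)) : ℝ := ∑ k ∈ t.objs, π k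

/-- `π_{Θ_a^i}`, the total weight of group-`i` objects at the node rooting `t`. -/
noncomputable def gmassGroup (π : ι → ℝ) (y : ι → Fin m) (i : Fin m)
    (t : BTree (Finset ι)) : ℝ :=
  ∑ k ∈ t.objs.filter (fun k => y k = i), π k

/-- Binary (Shannon) entropy of a proportion `ρ`, in bits; `Real.logb 2 0 = 0`
gives the convention `0 log₂ 0 = 0`. -/
noncomputable def binEnt (ρ : ℝ) : ℝ := -(ρ * Real.logb 2 ρ) - (1 - ρ) * Real.logb 2 (1 - ρ)

/-- The reduction factor `ρ_a = max(π_{Θ_{l(a)}}, π_{Θ_{r(a)}})/π_{Θ_a}` at the node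
rooting the subtree `t`. -/
noncomputable def redFactor (π : ι → ℝ) (t : BTree (Finset ι)) : ℝ :=
  max (gmass π t.left) (gmass π t.right) / gmass π t

/-- The group reduction factor `ρ_a^i = max(π_{Θ^i_{l(a)}}, π_{Θ^i_{r(a)}})/π_{Θ_a^i}`. -/
noncomputable def groupRedFactor (π : ι → ℝ) (y : ι → Fin m) (i : Fin m)
    (t : BTree (Finset ι)) : ℝ :=
  max (gmassGroup π y i t.left) (gmassGroup π y i t.right) / gmassGroup π y i t

theorem BTree.mem_objs {t : BTree (Finset ι)} {k : ι} : k ∈ t.objs ↔ ∃ S ∈ t.leaves, k ∈ S := by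
  induction t with
  | leaf S => simp [BTree.objs, BTree.leaves]
  | node l r ihl ihr =>
    simp only [BTree.objs, BTree.leaves, Finset.mem_union, ihl, ihr, List.mem_append, or_and_right,
      exists_or]

theorem BTree.disjoint_objs {l r : BTree (Finset ι)}
    (h : ∀ S ∈ l.leaves, ∀ S' ∈ r.leaves, Disjoint S S') : Disjoint l.objs r.objs := by
  rw [Finset.disjoint_left]
  intro k hl hr
  obtain ⟨S, hS, hkS⟩ := BTree.mem_objs.1 hl
  obtain ⟨S', hS', hkS'⟩ := BTree.mem_objs.1 hr
  exact Finset.disjoint_left.1 (h S hS S' hS') hkS hkS'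

theorem gmass_node (π : ι → ℝ) {l r : BTree (Finset ι)} (h : Disjoint l.objs r.objs) :
    gmass π (.node l r) = gmass π l + gmass π r :=
  Finset.sum_union h

theorem gmassGroup_node (π : ι → ℝ) (y : ι → Fin m) (i : Fin m) {l r : BTree (Finset ι)}
    (h : Disjoint l.objs r.objs) :
    gmassGroup π y i (.node l r) = gmassGroup π y i l + gmassGroup π y i r := by
  simp only [gmassGroup, BTree.objs, Finset.filter_union]
  exact Finset.sum_union (Finset.disjoint_filter_filter h)

theorem gmass_nonneg {π : ι → ℝ} (hπ : ∀ k, 0 ≤ π k) (t : BTree (Finset ι)) : 0 ≤ gmass π t :=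
  Finset.sum_nonneg fun k _ => hπ k

theorem gmassGroup_nonneg {π : ι → ℝ} (hπ : ∀ k, 0 ≤ π k) (y : ι → Fin m) (i : Fin m)
    (t : BTree (Finset ι)) : 0 ≤ gmassGroup π y i t :=
  Finset.sum_nonneg fun k _ => hπ k

theorem gmassGroup_le_gmass {π : ι → ℝ} (hπ : ∀ k, 0 ≤ π k) (y : ι → Fin m) (i : Fin m)
    (t : BTree (Finset ι)) : gmassGroup π y i t ≤ gmass π t :=
  Finset.sum_le_sum_of_subset_of_nonneg (Finset.filter_subset _ _) fun k _ _ => hπ k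

theorem sum_leavesD_mass (π : ι → ℝ) {t : BTree (Finset ι)} (h : t.leaves.Pairwise Disjoint) :
    (t.leavesD.map fun p => ∑ k ∈ p.1, π k).sum = gmass π t := by
  induction t with
  | leaf S => simp [BTree.leavesD, gmass, BTree.objs]
  | node l r ihl ihr =>
    obtain ⟨hl, hr, hlr⟩ := List.pairwise_append.1 h
    rw [gmass_node π (BTree.disjoint_objs hlr), ← ihl hl, ← ihr hr]
    simp [BTree.leavesD, Function.comp_def]

theorem sum_leavesD_depth_node (π : ι → ℝ) {l r : BTree (Finset ι)}
    (h : (BTree.node l r).leaves.Pairwise Disjoint) :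
    ((BTree.node l r).leavesD.map fun p => (∑ k ∈ p.1, π k) * (p.2 : ℝ)).sum
      = gmass π (.node l r) + (l.leavesD.map fun p => (∑ k ∈ p.1, π k) * (p.2 : ℝ)).sum
        + (r.leavesD.map fun p => (∑ k ∈ p.1, π k) * (p.2 : ℝ)).sum := by
  obtain ⟨hl, hr, hlr⟩ := List.pairwise_append.1 h
  rw [gmass_node π (BTree.disjoint_objs hlr), ← sum_leavesD_mass π hl, ← sum_leavesD_mass π hr]
  simp only [BTree.leavesD, List.map_append, List.map_map, Function.comp_def, List.sum_append,
    Nat.cast_add, Nat.cast_one, mul_add, mul_one, List.sum_map_add]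
  ring

theorem add_mul_binEnt_div {a b : ℝ} (ha : 0 ≤ a) (hb : 0 ≤ b) :
    (a + b) * binEnt (a / (a + b))
      = (a + b) * Real.logb 2 (a + b) - a * Real.logb 2 a - b * Real.logb 2 b := by
  rcases ha.eq_or_lt with rfl | ha
  · rcases hb.eq_or_lt with rfl | hb <;> simp [binEnt]
  rcases hb.eq_or_lt with rfl | hb
  · simp [binEnt, ha.ne']
  have hab : a + b ≠ 0 := by positivity
  have h : 1 - a / (a + b) = b / (a + b) := by field_simp; ring
  rw [binEnt, h, Real.logb_div ha.ne' hab, Real.logb_div hb.ne' hab]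
  field_simp
  ring

theorem add_mul_binEnt_max_div {a b : ℝ} (ha : 0 ≤ a) (hb : 0 ≤ b) :
    (a + b) * binEnt (max a b / (a + b))
      = (a + b) * Real.logb 2 (a + b) - a * Real.logb 2 a - b * Real.logb 2 b := by
  rcases le_total a b with h | h
  · rw [max_eq_right h, add_comm a b, add_mul_binEnt_div hb ha]
    ring
  · rw [max_eq_left h, add_mul_binEnt_div ha hb]

theorem gmass_mul_sum_pos_group {π : ι → ℝ} (hπ : ∀ k, 0 ≤ π k) (y : ι → Fin m)
    (t : BTree (Finset ι)) (f : Fin m → ℝ) :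
    gmass π t * ∑ i ∈ Finset.univ.filter (fun i => 0 < gmassGroup π y i t),
        (gmassGroup π y i t / gmass π t) * f i
      = ∑ i, gmassGroup π y i t * f i := by
  rw [Finset.mul_sum, Finset.sum_filter]
  refine Finset.sum_congr rfl fun i _ => ?_
  split_ifs with h
  · have := (h.trans_le (gmassGroup_le_gmass hπ y i t)).ne'
    field_simp
  · rw [le_antisymm (not_lt.1 h) (gmassGroup_nonneg hπ y i t), zero_mul]

/-- The contribution of an internal node telescopes along the tree. -/
theorem node_contribution_eq {π : ι → ℝ} (hπ : ∀ k, 0 ≤ π k) (y : ι → Fin m)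
    {l r : BTree (Finset ι)} (h : Disjoint l.objs r.objs) :
    gmass π (.node l r) * (1 - binEnt (redFactor π (.node l r))
        + ∑ i ∈ Finset.univ.filter (fun i => 0 < gmassGroup π y i (.node l r)),
            (gmassGroup π y i (.node l r) / gmass π (.node l r)) *
              binEnt (groupRedFactor π y i (.node l r)))
      = gmass π (.node l r)
        - (gmass π (.node l r) * Real.logb 2 (gmass π (.node l r))
          - gmass π l * Real.logb 2 (gmass π l) - gmass π r * Real.logb 2 (gmass π r))
        + (∑ i, gmassGroup π y i (.node l r) * Real.logb 2 (gmassGroup π y i (.node l r))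
          - ∑ i, gmassGroup π y i l * Real.logb 2 (gmassGroup π y i l)
          - ∑ i, gmassGroup π y i r * Real.logb 2 (gmassGroup π y i r)) := by
  rw [mul_add, mul_sub, mul_one, gmass_mul_sum_pos_group hπ, ← Finset.sum_sub_distrib,
    ← Finset.sum_sub_distrib]
  congr 1
  · congr 1
    simp only [redFactor, BTree.left, BTree.right, gmass_node π h]
    exact add_mul_binEnt_max_div (gmass_nonneg hπ l) (gmass_nonneg hπ r)
  · refine Finset.sum_congr rfl fun i _ => ?_
    simp only [groupRedFactor, BTree.left, BTree.right, gmassGroup_node π y i h]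
    exact add_mul_binEnt_max_div (gmassGroup_nonneg hπ y i l) (gmassGroup_nonneg hπ y i r)

theorem sum_gmassGroup_mul_logb_leaf (π : ι → ℝ) (y : ι → Fin m) {S : Finset ι}
    (hS : ∀ k ∈ S, ∀ k' ∈ S, y k = y k') :
    ∑ i, gmassGroup π y i (.leaf S) * Real.logb 2 (gmassGroup π y i (.leaf S))
      = gmass π (.leaf S) * Real.logb 2 (gmass π (.leaf S)) := by
  simp only [gmassGroup, gmass, BTree.objs]
  rcases S.eq_empty_or_nonempty with rfl | ⟨k₀, hk₀⟩
  · simp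
  · rw [Finset.sum_eq_single_of_mem (y k₀) (Finset.mem_univ _),
      Finset.filter_true_of_mem fun k hk => hS k hk k₀ hk₀]
    intro i _ hi
    rw [Finset.filter_false_of_mem fun k hk (hki : y k = i) => hi (hki.symm.trans (hS k hk k₀ hk₀))]
    simp

/-- The identity for trees of arbitrary total mass. -/
theorem sum_leavesD_depth_eq {π : ι → ℝ} (hπ : ∀ k, 0 ≤ π k) (y : ι → Fin m)
    {t : BTree (Finset ι)} (hdisj : t.leaves.Pairwise Disjoint)
    (hpure : ∀ S ∈ t.leaves, ∀ k ∈ S, ∀ k' ∈ S, y k = y k') :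
    (t.leavesD.map fun p => (∑ k ∈ p.1, π k) * (p.2 : ℝ)).sum
      = gmass π t * Real.logb 2 (gmass π t)
        - ∑ i, gmassGroup π y i t * Real.logb 2 (gmassGroup π y i t)
        + (t.internals.map fun p =>
            gmass π p.1 *
              (1 - binEnt (redFactor π p.1)
                + ∑ i ∈ Finset.univ.filter (fun i => 0 < gmassGroup π y i p.1),
                    (gmassGroup π y i p.1 / gmass π p.1) *
                      binEnt (groupRedFactor π y i p.1))).sum := by
  induction t with
  | leaf S =>
    rw [sum_gmassGroup_mul_logb_leaf π y (hpure S (by simp [BTree.leaves]))]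
    simp [BTree.leavesD, BTree.internals]
  | node l r ihl ihr =>
    obtain ⟨hl, hr, hlr⟩ := List.pairwise_append.1 hdisj
    rw [sum_leavesD_depth_node π hdisj,
      ihl hl fun S hS => hpure S (List.mem_append_left _ hS),
      ihr hr fun S hS => hpure S (List.mem_append_right _ hS)]
    simp only [BTree.internals, List.map_cons, List.map_append, List.map_map, Function.comp_def,
      List.sum_cons, List.sum_append]
    rw [node_contribution_eq hπ y (BTree.disjoint_objs hlr)]
    ring

/-- **Corollary (average case, group identification).** The expected number of queries to
identify the group satisfies the exact identity
`∑_{j ∈ leaves} π_{Θ_j} d_j = H(Π_y)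
  + ∑_{a ∈ I} π_{Θ_a} [1 - H(ρ_a) + ∑_{i : π_{Θ_a^i} > 0} (π_{Θ_a^i}/π_{Θ_a}) H(ρ_a^i)]`. -/
theorem group_expected_depth_identity {ι : Type} [Fintype ι] [DecidableEq ι] {m : ℕ}
    (π : ι → ℝ) (hπ : ∀ k, 0 < π k) (hsum : ∑ k, π k = 1) (y : ι → Fin m)
    (T : BTree (Finset ι))
    (hne : ∀ S ∈ T.leaves, S.Nonempty)
    (hdisj : T.leaves.Pairwise Disjoint)
    (hunion : T.objs = Finset.univ)
    (hpure : ∀ S ∈ T.leaves, ∀ k ∈ S, ∀ k' ∈ S, y k = y k') :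
    (T.leavesD.map fun p => (∑ k ∈ p.1, π k) * (p.2 : ℝ)).sum
      = (- ∑ i : Fin m, (∑ k ∈ Finset.univ.filter (fun k => y k = i), π k) *
            Real.logb 2 (∑ k ∈ Finset.univ.filter (fun k => y k = i), π k))
        + (T.internals.map fun p =>
            gmass π p.1 *
              (1 - binEnt (redFactor π p.1)
                + ∑ i ∈ Finset.univ.filter (fun i => 0 < gmassGroup π y i p.1),
                    (gmassGroup π y i p.1 / gmass π p.1) *
                      binEnt (groupRedFactor π y i p.1))).sum := by
  have hmass : gmass π T = 1 := by rw [gmass, hunion, hsum]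
  rw [sum_leavesD_depth_eq (fun k => (hπ k).le) y hdisj hpure, hmass, Real.logb_one, mul_zero,
    zero_sub]
  congr 2
  simp only [gmassGroup, hunion]
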